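/- Fix μ ∈ (1/2,1), set α = 2 − 1/μ, and fix r > 0. For t > 0 let ω_t be the Kaden vorticity (the pushforward under γ_t(s) = s·exp(i·(t/(2π))·s^{−1/μ}) of the measure (2 − 1/μ)·s^{1−1/μ} ds on (0,∞)), and let ω₀ be the measure on the positive real half-line given by dω₀(x) = α·x^{α−1} dx on (0,∞). Let u(t) and u₀ denote the Biot-Savart velocities of ω_t and ω₀ respectively. Then lim_{t→0⁺} ∫_{B(0,r)} |u(t)(x) − u₀(x)|² dx = 0; in particular lim_{t→0⁺} E_r(ω_t) = E_r(ω₀). -/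

import Mathlib

open MeasureTheory Metric Real Filter
open scoped ENNReal NNReal Topology

/-- Biot-Savart velocity field of a vorticity measure `ω` on `ℂ = ℝ²`:
`v(z) = (2π)⁻¹ ∫ i (z - u) / |z - u|² dω(u)`. -/
noncomputable def biotSavart (ω : Measure ℂ) (z : ℂ) : ℂ :=
  (2 * π)⁻¹ • ∫ u, Complex.I * (z - u) / (((‖z - u‖ : ℝ) : ℂ) ^ 2) ∂ω

/-- Local kinetic energy `E_r(ω) = ∫_{B(0,r)} |v|²`. -/
noncomputable def localEnergy (ω : Measure ℂ) (r : ℝ) : ℝ≥0∞ :=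
  ∫⁻ x in ball (0 : ℂ) r, (‖biotSavart ω x‖₊ : ℝ≥0∞) ^ 2

/-- Spherical average `A_r(ω) = (2π)⁻¹ ∫_0^{2π} |v(r e^{iθ})|² dθ`. -/
noncomputable def sphAvg (ω : Measure ℂ) (r : ℝ) : ℝ≥0∞ :=
  (ENNReal.ofReal (2 * π))⁻¹ *
    ∫⁻ θ in Set.Ioo (0 : ℝ) (2 * π),
      (‖biotSavart ω ((r : ℂ) * Complex.exp ((θ : ℂ) * Complex.I))‖₊ : ℝ≥0∞) ^ 2

/-- Inner moments `m_{r,n}(ω) = ∫_{B(0,r)} uⁿ dω(u)` (for `n = 0` this is `ω(B(0,r))`). -/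
noncomputable def innerMoment (ω : Measure ℂ) (r : ℝ) (n : ℕ) : ℂ :=
  ∫ u in ball (0 : ℂ) r, u ^ n ∂ω

/-- Outer moments `M_{r,k}(ω) = ∫_{ℂ ∖ B(0,r)} u⁻ᵏ dω(u)`. -/
noncomputable def outerMoment (ω : Measure ℂ) (r : ℝ) (k : ℕ) : ℂ :=
  ∫ u in (ball (0 : ℂ) r)ᶜ, u ^ (-(k : ℤ)) ∂ω

/-- The parametrization of the Kaden spiral: `γ_t(s) = s·exp(i·(t/(2π))·s^{-1/μ})`. -/
noncomputable def kadenCurve (μ t s : ℝ) : ℂ :=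
  (s : ℂ) * Complex.exp (Complex.I * ((t / (2 * π) * s ^ (-1 / μ) : ℝ) : ℂ))

/-- The Kaden vorticity `ω_t`: the pushforward under `γ_t` of the measure
`(2 - 1/μ)·s^{1-1/μ} ds` on `(0,∞)`. -/
noncomputable def kadenMeasure (μ t : ℝ) : Measure ℂ :=
  Measure.map (kadenCurve μ t)
    (((volume : Measure ℝ).restrict (Set.Ioi 0)).withDensity
      (fun s => ENNReal.ofReal ((2 - 1 / μ) * s ^ (1 - 1 / μ))))

/-- The circle integral of the squared modulus of the Cauchy kernel. -/
lemma lintegral_circle_inv_sq_le {ρ : ℝ} (hρ : 0 < ρ) {b : ℂ} (hb : ‖b‖ ≠ ρ) :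
    ∫⁻ θ in Set.Ioo (-π) π, (‖circleMap 0 ρ θ - b‖ₑ ^ 2)⁻¹ ≤
      ENNReal.ofReal (2 * π / |ρ ^ 2 - ‖b‖ ^ 2|) := by
  have hne : ∀ θ, circleMap 0 ρ θ - b ≠ 0 := by
    intro θ h
    apply hb
    rw [← sub_eq_zero.1 h, norm_circleMap_zero, abs_of_pos hρ]
  have hcont : Continuous fun θ => (‖circleMap 0 ρ θ - b‖ ^ 2)⁻¹ :=
    Continuous.inv₀ (by fun_prop) fun θ => by simpa using hne θ
  -- the Poisson formula, for both positions of `b`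
  have key : ∀ {R : ℝ} {w : ℂ}, 0 < R → ‖w‖ < R →
      ∫ θ in (0 : ℝ)..2 * π, (‖circleMap 0 R θ - w‖ ^ 2)⁻¹ = 2 * π / (R ^ 2 - ‖w‖ ^ 2) := by
    intro R w hR hw
    have h := DiffContOnCl.circleAverage_poissonKernel_smul' (c := 0) (R := R) (w := w)
      (f := fun _ => (1 : ℂ)) diffContOnCl_const (by simpa using hw)
    have hpos : 0 < R ^ 2 - ‖w‖ ^ 2 := by
      have := norm_nonneg w
      nlinarith
    have h2 : (2 * π)⁻¹ * ((R ^ 2 - ‖w‖ ^ 2) *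
        ∫ θ in (0 : ℝ)..2 * π, (‖circleMap 0 R θ - w‖ ^ 2)⁻¹) = 1 := by
      rw [circleAverage] at h
      simp only [sub_zero, norm_circleMap_zero, sq_abs, Complex.real_smul, mul_one] at h
      rw [intervalIntegral.integral_ofReal] at h
      simp only [div_eq_mul_inv, intervalIntegral.integral_const_mul] at h
      exact_mod_cast h
    have := Real.pi_pos
    field_simp at h2 ⊢
    linarith
  have hsymm : ∀ θ, ‖circleMap 0 ρ θ - b‖ =
      ‖circleMap 0 ‖b‖ θ - ρ * Complex.exp (b.arg * Complex.I)‖ := by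
    intro θ
    have hb' : b = ‖b‖ * Complex.exp (b.arg * Complex.I) := (Complex.norm_mul_exp_arg_mul_I b).symm
    rw [← sq_eq_sq₀ (norm_nonneg _) (norm_nonneg _), ← Complex.normSq_eq_norm_sq,
      ← Complex.normSq_eq_norm_sq]
    conv_lhs => rw [hb']
    generalize ‖b‖ = s
    generalize b.arg = φ
    simp only [circleMap_zero, Complex.normSq_apply, Complex.exp_ofReal_mul_I_re,
      Complex.exp_ofReal_mul_I_im, Complex.sub_re, Complex.sub_im, Complex.mul_re, Complex.mul_im,
      Complex.ofReal_re, Complex.ofReal_im]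
    have h1 := Real.sin_sq_add_cos_sq θ
    have h2 := Real.sin_sq_add_cos_sq φ
    linear_combination (ρ^2 - s^2) * h1 + (s^2 - ρ^2) * h2
  have hint : ∫ θ in (0 : ℝ)..2 * π, (‖circleMap 0 ρ θ - b‖ ^ 2)⁻¹ =
      2 * π / |ρ ^ 2 - ‖b‖ ^ 2| := by
    rcases lt_or_gt_of_ne hb with h | h
    · rw [key hρ h, abs_of_pos]
      have := norm_nonneg b
      nlinarith
    · simp_rw [hsymm]
      rw [key (hρ.trans h)]
      · simp only [norm_mul, Complex.norm_real, Complex.norm_exp_ofReal_mul_I, mul_one, norm_eq_abs,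
          sq_abs]
        rw [abs_of_neg (by nlinarith)]
        ring
      · simpa [abs_of_pos hρ] using h
  have hper : Function.Periodic (fun θ => (‖circleMap 0 ρ θ - b‖ ^ 2)⁻¹) (2 * π) := by
    intro θ
    simp only [periodic_circleMap 0 ρ θ]
  have hshift := hper.intervalIntegral_add_eq (-π) 0
  rw [zero_add, hint, show -π + 2 * π = π by ring,
    intervalIntegral.integral_of_le (by linarith [Real.pi_pos]),
    integral_Ioc_eq_integral_Ioo] at hshift
  rw [← hshift, ofReal_integral_eq_lintegral_ofReal]
  · refine le_of_eq (lintegral_congr fun θ => ?_)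
    rw [ENNReal.ofReal_inv_of_pos (by have := norm_pos_iff.2 (hne θ); positivity),
      ENNReal.ofReal_pow (norm_nonneg _), ofReal_norm]
  · exact (hcont.integrableOn_Icc).mono_set Set.Ioo_subset_Icc_self
  · exact .of_forall fun θ => by positivity

/-- Weighted Cauchy-Schwarz inequality for lower integrals. -/
lemma sq_lintegral_le_weight {X : Type*} [MeasurableSpace X] {ν : Measure X} {f h : X → ℝ≥0∞}
    (hf : AEMeasurable f ν) (hh : AEMeasurable h ν) (h0 : ∀ᵐ x ∂ν, h x ≠ 0)
    (ht : ∀ᵐ x ∂ν, h x ≠ ∞) :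
    (∫⁻ x, f x ∂ν) ^ 2 ≤ (∫⁻ x, h x ∂ν) * ∫⁻ x, (h x)⁻¹ * f x ^ 2 ∂ν := by
  have hpq : (2 : ℝ).HolderConjugate 2 := Real.HolderConjugate.two_two
  have hCS := ENNReal.lintegral_mul_le_Lp_mul_Lq ν hpq
    (f := fun x => h x ^ (1 / 2 : ℝ)) (g := fun x => (h x)⁻¹ ^ (1 / 2 : ℝ) * f x)
    (hh.pow_const _) ((hh.inv.pow_const _).mul hf)
  have e0 : ∫⁻ x, f x ∂ν = ∫⁻ x, ((fun x => h x ^ (1 / 2 : ℝ)) *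
      fun x => (h x)⁻¹ ^ (1 / 2 : ℝ) * f x) x ∂ν := by
    refine lintegral_congr_ae ?_
    filter_upwards [h0, ht] with x hx hx'
    simp only [Pi.mul_apply]
    rw [← mul_assoc, ← ENNReal.mul_rpow_of_nonneg _ _ (by norm_num), ENNReal.mul_inv_cancel hx hx',
      ENNReal.one_rpow, one_mul]
  have hhalf : ∀ a : ℝ≥0∞, (a ^ (1 / 2 : ℝ)) ^ (2 : ℝ) = a := fun a => by
    rw [← ENNReal.rpow_mul]; norm_num
  have hhalf' : ∀ a : ℝ≥0∞, (a ^ (1 / 2 : ℝ)) ^ 2 = a := fun a => by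
    rw [← ENNReal.rpow_natCast]; exact hhalf a
  rw [← e0] at hCS
  refine (pow_le_pow_left' hCS 2).trans (le_of_eq ?_)
  rw [mul_pow, hhalf', hhalf']
  simp only [hhalf, ENNReal.mul_rpow_of_nonneg _ _ (zero_le_two (α := ℝ)), ENNReal.rpow_ofNat]

/-- The radial weight `|ρ² - s²|^(-1/2)`. -/
noncomputable def radialWeight (ρ s : ℝ) : ℝ≥0∞ :=
  ENNReal.ofReal (|ρ ^ 2 - s ^ 2| ^ (-1 / 2 : ℝ))

lemma measurable_radialWeight : Measurable (Function.uncurry radialWeight) := by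
  unfold radialWeight Function.uncurry
  fun_prop

lemma measurable_radialWeight_right (ρ : ℝ) : Measurable (radialWeight ρ) := by
  unfold radialWeight
  fun_prop

lemma radialWeight_ne_zero {ρ s : ℝ} (hρ : 0 < ρ) (hs : 0 < s) (h : s ≠ ρ) :
    radialWeight ρ s ≠ 0 := by
  have : 0 < |ρ ^ 2 - s ^ 2| := abs_pos.2 <| by
    rw [sq_sub_sq]
    exact mul_ne_zero (by positivity) (sub_ne_zero.2 h.symm)
  simp only [radialWeight, ne_eq, ENNReal.ofReal_eq_zero, not_le]
  positivity

lemma radialWeight_sq {ρ s : ℝ} : radialWeight ρ s ^ 2 = ENNReal.ofReal (|ρ ^ 2 - s ^ 2|⁻¹) := by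
  rw [radialWeight, ← ENNReal.ofReal_pow (by positivity), ← Real.rpow_mul_natCast (abs_nonneg _)]
  norm_num [Real.rpow_neg_one]

lemma inv_radialWeight_mul_sq_le (C : ℝ≥0∞) (ρ s : ℝ) :
    (radialWeight ρ s)⁻¹ * (C * radialWeight ρ s ^ 2) ≤ C * radialWeight ρ s := by
  have ht : radialWeight ρ s ≠ ∞ := ENNReal.ofReal_ne_top
  rcases eq_or_ne (radialWeight ρ s) 0 with h | h
  · simp [h]
  · rw [sq, mul_left_comm C, ← mul_assoc, ENNReal.inv_mul_cancel h ht, one_mul]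

/-- The measure `α s^(α-1) ds` on `(0, ∞)`. -/
noncomputable def powerMeasure (α : ℝ) : Measure ℝ :=
  ((volume : Measure ℝ).restrict (Set.Ioi 0)).withDensity
    (fun s => ENNReal.ofReal (α * s ^ (α - 1)))

instance (α : ℝ) : SFinite (powerMeasure α) := by
  unfold powerMeasure; infer_instance

lemma powerMeasure_absolutelyContinuous (α : ℝ) :
    powerMeasure α ≪ (volume : Measure ℝ).restrict (Set.Ioi 0) :=
  withDensity_absolutelyContinuous _ _

lemma ae_powerMeasure_pos_ne (α ρ : ℝ) : ∀ᵐ s ∂powerMeasure α, 0 < s ∧ s ≠ ρ := by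
  refine powerMeasure_absolutelyContinuous α ?_
  filter_upwards [ae_restrict_mem measurableSet_Ioi,
    Measure.ae_ne ((volume : Measure ℝ).restrict (Set.Ioi 0)) ρ] with s hs hs'
  exact ⟨hs, hs'⟩

/-- The mass of the radial weight with respect to the power measure. -/
noncomputable def radialMass (α ρ : ℝ) : ℝ≥0∞ := ∫⁻ s, radialWeight ρ s ∂powerMeasure α

lemma measurable_radialMass (α : ℝ) : Measurable (radialMass α) :=
  measurable_radialWeight.lintegral_prod_right'

/-- The parameter measure `dρ ⊗ α s^(α-1) ds` on `(0, r) × (0, ∞)`. -/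
noncomputable def radialProd (α r : ℝ) : Measure (ℝ × ℝ) :=
  ((volume : Measure ℝ).restrict (Set.Ioo 0 r)).prod (powerMeasure α)

/-- The angular integral of `f²`, weighted by the radial factors coming from the weighted
Cauchy-Schwarz inequality on the circle of radius `p.1`. -/
noncomputable def angularDensity (α : ℝ) (f : ℝ → ℂ → ℝ≥0∞) (p : ℝ × ℝ) : ℝ≥0∞ :=
  ENNReal.ofReal p.1 * radialMass α p.1 * ((radialWeight p.1 p.2)⁻¹ *
    ∫⁻ θ in Set.Ioo (-π) π, f p.2 (circleMap 0 p.1 θ) ^ 2)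

lemma measurable_circleMap_uncurry : Measurable fun q : ℝ × ℝ => circleMap 0 q.1 q.2 := by
  simp only [circleMap_zero]
  fun_prop

lemma measurable_angularDensity (α : ℝ) {f : ℝ → ℂ → ℝ≥0∞} (hf : Measurable (Function.uncurry f)) :
    Measurable (angularDensity α f) := by
  unfold angularDensity
  have h1 : Measurable fun q : (ℝ × ℝ) × ℝ => f q.1.2 (circleMap 0 q.1.1 q.2) ^ 2 := by
    refine Measurable.pow_const ?_ 2
    exact hf.comp (measurable_fst.snd.prodMk
      (measurable_circleMap_uncurry.comp (measurable_fst.fst.prodMk measurable_snd)))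
  have h2 := h1.lintegral_prod_right' (ν := (volume : Measure ℝ).restrict (Set.Ioo (-π) π))
  have h3 : Measurable fun p : ℝ × ℝ => radialMass α p.1 :=
    (measurable_radialMass α).comp measurable_fst
  exact (measurable_fst.ennreal_ofReal.mul h3).mul (measurable_radialWeight.inv.mul h2)

/-- `L²` bound on a disc for a superposition of functions, in terms of the angular integrals. -/
lemma lintegral_ball_sq_le (α r : ℝ) {f : ℝ → ℂ → ℝ≥0∞} (hf : Measurable (Function.uncurry f)) :
    ∫⁻ z in ball (0 : ℂ) r, (∫⁻ s, f s z ∂powerMeasure α) ^ 2 ≤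
      ∫⁻ p, angularDensity α f p ∂radialProd α r := by
  set ν := powerMeasure α
  have hG : Measurable fun z => (∫⁻ s, f s z ∂ν) ^ 2 :=
    (hf.lintegral_prod_left').pow_const 2
  have hball : MeasurableSet (ball (0 : ℂ) r) := measurableSet_ball
  rw [← lintegral_indicator hball, ← Complex.lintegral_comp_polarCoord_symm]
  have hpol : ∀ p, Complex.polarCoord.symm p = circleMap 0 p.1 p.2 := fun p => by
    rw [Complex.polarCoord_symm_apply, circleMap_zero, Complex.exp_mul_I]; push_cast; ring
  simp only [hpol, smul_eq_mul]
  rw [polarCoord_target, Measure.volume_eq_prod, ← Measure.prod_restrict, lintegral_prod _ (by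
    refine Measurable.aemeasurable ?_
    exact measurable_fst.ennreal_ofReal.mul
      ((hG.indicator hball).comp measurable_circleMap_uncurry))]
  rw [radialProd, lintegral_prod _ (measurable_angularDensity α hf).aemeasurable,
    ← lintegral_indicator measurableSet_Ioi, ← lintegral_indicator measurableSet_Ioo]
  refine lintegral_mono fun ρ => ?_
  by_cases hρ : 0 < ρ
  swap
  · simp [hρ]
  by_cases hρr : ρ < r
  swap
  · have : ∀ θ, circleMap 0 ρ θ ∉ ball (0 : ℂ) r := fun θ => by
      simpa [abs_of_pos hρ] using hρr
    rw [Set.indicator_of_mem (show ρ ∈ Set.Ioi 0 from hρ)]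
    simp only [Set.indicator_of_notMem (this _), mul_zero, lintegral_zero]
    exact zero_le
  have hmem : ∀ θ, circleMap 0 ρ θ ∈ ball (0 : ℂ) r := fun θ => by
    simpa [abs_of_pos hρ] using hρr
  rw [Set.indicator_of_mem (show ρ ∈ Set.Ioi 0 from hρ),
    Set.indicator_of_mem (show ρ ∈ Set.Ioo 0 r from ⟨hρ, hρr⟩)]
  simp only [Set.indicator_of_mem (hmem _), angularDensity]
  have hfθ : Measurable fun q : ℝ × ℝ => f q.2 (circleMap 0 ρ q.1) :=
    hf.comp (measurable_snd.prodMk (measurable_circleMap_uncurry.comp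
      (measurable_const.prodMk measurable_fst)))
  have hw := measurable_radialWeight_right ρ
  calc ∫⁻ θ in Set.Ioo (-π) π, ENNReal.ofReal ρ * (∫⁻ s, f s (circleMap 0 ρ θ) ∂ν) ^ 2
      ≤ ∫⁻ θ in Set.Ioo (-π) π, ENNReal.ofReal ρ * (radialMass α ρ *
          ∫⁻ s, (radialWeight ρ s)⁻¹ * f s (circleMap 0 ρ θ) ^ 2 ∂ν) := by
        refine lintegral_mono fun θ => ?_
        gcongr
        refine sq_lintegral_le_weight
          (hfθ.comp measurable_prodMk_left).aemeasurable hw.aemeasurable ?_ ?_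
        · filter_upwards [ae_powerMeasure_pos_ne α ρ] with s hs
          exact radialWeight_ne_zero hρ hs.1 hs.2
        · exact .of_forall fun s => ENNReal.ofReal_ne_top
    _ = ENNReal.ofReal ρ * radialMass α ρ * ∫⁻ θ in Set.Ioo (-π) π,
          ∫⁻ s, (radialWeight ρ s)⁻¹ * f s (circleMap 0 ρ θ) ^ 2 ∂ν := by
        simp_rw [← mul_assoc]
        rw [lintegral_const_mul]
        exact ((hw.inv.comp measurable_snd).mul (hfθ.pow_const 2)).lintegral_prod_right'
    _ = ∫⁻ s, ENNReal.ofReal ρ * radialMass α ρ * ((radialWeight ρ s)⁻¹ *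
          ∫⁻ θ in Set.Ioo (-π) π, f s (circleMap 0 ρ θ) ^ 2) ∂ν := by
        have hmeas := (hw.inv.comp measurable_snd).mul (hfθ.pow_const 2)
        rw [lintegral_lintegral_swap hmeas.aemeasurable, ← lintegral_const_mul]
        · refine lintegral_congr fun s => ?_
          rw [lintegral_const_mul]
          exact (hfθ.comp measurable_prodMk_right).pow_const 2
        · exact hmeas.lintegral_prod_left'
    _ = _ := rfl

/-- Scaling of the radial mass. -/
lemma radialMass_eq {α : ℝ} (hα : 0 < α) {ρ : ℝ} (hρ : 0 < ρ) :
    radialMass α ρ = ENNReal.ofReal (ρ ^ (α - 1)) * radialMass α 1 := by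
  have hd : ∀ ρ, radialMass α ρ = ∫⁻ s in Set.Ioi (0 : ℝ),
      ENNReal.ofReal (α * s ^ (α - 1)) * radialWeight ρ s := fun ρ => by
    rw [radialMass, powerMeasure, lintegral_withDensity_eq_lintegral_mul]
    · rfl
    · fun_prop
    · exact measurable_radialWeight_right ρ
  have himg : (fun x => ρ * x) '' Set.Ioi 0 = Set.Ioi 0 := by
    rw [Set.image_mul_left_Ioi hρ, mul_zero]
  rw [hd ρ, hd 1]
  conv_lhs => rw [← himg]
  rw [lintegral_image_eq_lintegral_abs_deriv_mul measurableSet_Ioi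
    (f' := fun _ => ρ) (fun x _ => by
      simpa using ((hasDerivAt_id x).const_mul ρ).hasDerivWithinAt)
    (mul_right_injective₀ hρ.ne').injOn, ← lintegral_const_mul']
  swap
  · exact ENNReal.ofReal_ne_top
  refine setLIntegral_congr_fun measurableSet_Ioi fun x hx => ?_
  have hx : 0 < x := hx
  simp only [radialWeight]
  rw [← ENNReal.ofReal_mul (by positivity), ← ENNReal.ofReal_mul (by positivity),
    ← ENNReal.ofReal_mul (by positivity), ← ENNReal.ofReal_mul (by positivity)]
  congr 1
  rw [show ρ ^ 2 - (ρ * x) ^ 2 = ρ ^ 2 * (1 ^ 2 - x ^ 2) by ring, abs_mul,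
    Real.mul_rpow (abs_nonneg _) (abs_nonneg _), Real.mul_rpow hρ.le hx.le, abs_of_pos hρ,
    abs_of_pos (by positivity : 0 < ρ ^ 2), ← Real.rpow_natCast_mul hρ.le]
  have : ρ * ρ ^ (((2 : ℕ) : ℝ) * (-1 / 2)) = 1 := by
    norm_num [Real.rpow_neg_one, hρ.ne']
  linear_combination (α * ρ ^ (α - 1) * x ^ (α - 1) * |1 ^ 2 - x ^ 2| ^ (-1 / 2 : ℝ)) * this

lemma integrableOn_rpow_mul_abs_rpow {α : ℝ} (h0 : 0 < α) (h1 : α < 1) :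
    IntegrableOn (fun s : ℝ => s ^ (α - 1) * |1 ^ 2 - s ^ 2| ^ (-1 / 2 : ℝ)) (Set.Ioi 0) := by
  have hmeas : Measurable fun s : ℝ => s ^ (α - 1) * |1 ^ 2 - s ^ 2| ^ (-1 / 2 : ℝ) := by fun_prop
  have hdom : ∀ {S : Set ℝ} {g : ℝ → ℝ}, MeasurableSet S → IntegrableOn g S →
      (∀ s ∈ S, 0 < s ∧ s ^ (α - 1) * |1 ^ 2 - s ^ 2| ^ (-1 / 2 : ℝ) ≤ 2 * g s) →
      IntegrableOn (fun s : ℝ => s ^ (α - 1) * |1 ^ 2 - s ^ 2| ^ (-1 / 2 : ℝ)) S := by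
    intro S g hS hg hle
    refine Integrable.mono' (hg.const_mul 2) hmeas.aestronglyMeasurable ?_
    filter_upwards [ae_restrict_mem hS] with s hs
    have := (hle s hs).1
    rw [Real.norm_of_nonneg (by positivity)]
    exact (hle s hs).2
  -- comparison of the singular factor near `s = 1`
  have hmid : ∀ s : ℝ, 1 / 2 < s → s ≠ 1 →
      s ^ (α - 1) * |1 ^ 2 - s ^ 2| ^ (-1 / 2 : ℝ) ≤ 2 * |1 - s| ^ (-1 / 2 : ℝ) := by
    intro s hs hs1
    have ha : s ^ (α - 1) ≤ 2 := by
      calc s ^ (α - 1) ≤ (1 / 2 : ℝ) ^ (α - 1) :=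
            Real.rpow_le_rpow_of_nonpos (by norm_num) hs.le (by linarith)
        _ ≤ (1 / 2 : ℝ) ^ (-1 : ℝ) :=
            Real.rpow_le_rpow_of_exponent_ge (by norm_num) (by norm_num) (by linarith)
        _ = 2 := by norm_num [Real.rpow_neg_one]
    have hpos : 0 < |1 - s| := abs_pos.2 (sub_ne_zero.2 hs1.symm)
    have hb : |1 ^ 2 - s ^ 2| ^ (-1 / 2 : ℝ) ≤ |1 - s| ^ (-1 / 2 : ℝ) := by
      refine Real.rpow_le_rpow_of_nonpos hpos ?_ (by norm_num)
      rw [sq_sub_sq, abs_mul, abs_of_pos (by linarith : 0 < 1 + s)]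
      nlinarith
    gcongr
  have hsplit : Set.Ioi (0 : ℝ) ⊆
      Set.Ioc 0 (1 / 2) ∪ Set.Ioo (1 / 2) 1 ∪ {1} ∪ Set.Ioc 1 2 ∪ Set.Ioi 2 := by
    intro s hs
    simp only [Set.mem_union, Set.mem_Ioc, Set.mem_Ioo, Set.mem_Ioi, Set.mem_singleton_iff] at hs ⊢
    grind
  refine IntegrableOn.mono_set ?_ hsplit
  refine (((IntegrableOn.union ?_ ?_).union ?_).union ?_).union ?_
  · refine hdom measurableSet_Ioc (g := fun s => s ^ (α - 1))
      ((intervalIntegrable_iff_integrableOn_Ioc_of_le (by norm_num)).1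
        (intervalIntegral.intervalIntegrable_rpow' (by linarith))) fun s hs => ⟨hs.1, ?_⟩
    have := hs.1
    rw [mul_comm]
    gcongr
    calc |1 ^ 2 - s ^ 2| ^ (-1 / 2 : ℝ) ≤ (1 / 4 : ℝ) ^ (-1 / 2 : ℝ) := by
          refine Real.rpow_le_rpow_of_nonpos (by norm_num) ?_ (by norm_num)
          rw [abs_of_pos] <;> nlinarith [hs.2]
      _ = 2 := by
          rw [show (1 / 4 : ℝ) = (2 : ℝ) ^ (-2 : ℝ) by norm_num, ← Real.rpow_mul (by norm_num)]
          norm_num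
  · have hi : IntegrableOn (fun s : ℝ => (1 - s) ^ (-1 / 2 : ℝ)) (Set.Ioo (1 / 2) 1) := by
      have := (intervalIntegral.intervalIntegrable_rpow' (a := 0) (b := 1 / 2)
        (r := -1 / 2) (by norm_num)).comp_sub_left 1
      rw [sub_zero, show (1 : ℝ) - 1 / 2 = 1 / 2 by norm_num] at this
      exact ((intervalIntegrable_iff_integrableOn_Ioo_of_le (by norm_num)).1 this.symm)
    refine hdom measurableSet_Ioo hi fun s hs => ⟨by linarith [hs.1], ?_⟩
    rw [← abs_of_pos (sub_pos.2 hs.2)]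
    simpa using hmid s hs.1 hs.2.ne
  · exact integrableOn_singleton (hx := by simp)
  · have hi : IntegrableOn (fun s : ℝ => (s - 1) ^ (-1 / 2 : ℝ)) (Set.Ioc 1 2) := by
      have := (intervalIntegral.intervalIntegrable_rpow' (a := 0) (b := 1)
        (r := -1 / 2) (by norm_num)).comp_sub_right 1
      rw [zero_add, show (1 : ℝ) + 1 = 2 by norm_num] at this
      exact ((intervalIntegrable_iff_integrableOn_Ioc_of_le (by norm_num)).1 this)
    refine hdom measurableSet_Ioc hi fun s hs => ⟨by linarith [hs.1], ?_⟩
    rw [← abs_of_pos (sub_pos.2 hs.1), abs_sub_comm s 1]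
    exact hmid s (by linarith [hs.1]) hs.1.ne'
  · refine hdom measurableSet_Ioi (g := fun s => s ^ (α - 2))
      (integrableOn_Ioi_rpow_of_lt (by linarith) (by norm_num)) fun s hs => ?_
    have hs2 : 2 < s := hs
    have hs0 : 0 < s := by linarith
    refine ⟨hs0, ?_⟩
    have hb : |1 ^ 2 - s ^ 2| ^ (-1 / 2 : ℝ) ≤ 2 * s ^ (-1 : ℝ) := by
      calc |1 ^ 2 - s ^ 2| ^ (-1 / 2 : ℝ) ≤ ((2⁻¹ * s) ^ 2) ^ (-1 / 2 : ℝ) := by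
            refine Real.rpow_le_rpow_of_nonpos (by positivity) ?_ (by norm_num)
            rw [abs_of_neg] <;> nlinarith
        _ = 2 * s ^ (-1 : ℝ) := by
            rw [← Real.rpow_natCast_mul (by positivity)]
            norm_num [Real.rpow_neg_one, mul_comm]
    calc s ^ (α - 1) * |1 ^ 2 - s ^ 2| ^ (-1 / 2 : ℝ) ≤ s ^ (α - 1) * (2 * s ^ (-1 : ℝ)) := by
          gcongr
      _ = 2 * s ^ (α - 2) := by
          rw [mul_left_comm, ← Real.rpow_add hs0]
          ring_nf

lemma radialMass_one_ne_top {α : ℝ} (h0 : 0 < α) (h1 : α < 1) : radialMass α 1 ≠ ∞ := by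
  rw [radialMass, powerMeasure, lintegral_withDensity_eq_lintegral_mul _ (by fun_prop)
    (measurable_radialWeight_right 1)]
  refine ne_of_lt ?_
  refine lt_of_le_of_lt (le_of_eq ?_)
    ((integrableOn_rpow_mul_abs_rpow h0 h1).const_mul α).lintegral_lt_top
  refine setLIntegral_congr_fun measurableSet_Ioi fun s hs => ?_
  have hs : 0 < s := hs
  simp only [Pi.mul_apply, radialWeight]
  rw [← ENNReal.ofReal_mul (by positivity), mul_assoc]

/-- The dominating function for the angular densities has finite integral. -/
lemma lintegral_dominating_ne_top {α : ℝ} (h0 : 0 < α) (h1 : α < 1) (r : ℝ) {C : ℝ≥0∞}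
    (hC : C ≠ ∞) :
    ∫⁻ p, ENNReal.ofReal p.1 * radialMass α p.1 * (C * radialWeight p.1 p.2) ∂radialProd α r
      ≠ ∞ := by
  have hM : Measurable fun p : ℝ × ℝ => radialMass α p.1 :=
    (measurable_radialMass α).comp measurable_fst
  have hw : Measurable fun p : ℝ × ℝ => radialWeight p.1 p.2 := measurable_radialWeight
  rw [radialProd, lintegral_prod _ (by fun_prop)]
  have hinner : ∀ ρ ∈ Set.Ioo 0 r, ∫⁻ s, ENNReal.ofReal ρ * radialMass α ρ *
      (C * radialWeight ρ s) ∂powerMeasure α =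
      ENNReal.ofReal (ρ ^ (2 * α - 1)) * (C * radialMass α 1 ^ 2) := by
    intro ρ hρ
    have hρ0 : 0 < ρ := hρ.1
    have hwρ := measurable_radialWeight_right ρ
    rw [lintegral_const_mul _ (by fun_prop), lintegral_const_mul _ hwρ, ← radialMass,
      radialMass_eq h0 hρ0]
    have : ENNReal.ofReal (ρ ^ (2 * α - 1)) =
        ENNReal.ofReal ρ * ENNReal.ofReal (ρ ^ (α - 1)) * ENNReal.ofReal (ρ ^ (α - 1)) := by
      rw [← ENNReal.ofReal_mul (by positivity), ← ENNReal.ofReal_mul (by positivity)]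
      congr 1
      nth_rw 2 [← Real.rpow_one ρ]
      rw [← Real.rpow_add hρ0, ← Real.rpow_add hρ0]
      ring_nf
    rw [this]
    ring
  rw [setLIntegral_congr_fun measurableSet_Ioo hinner,
    lintegral_mul_const _ (by fun_prop)]
  refine ENNReal.mul_ne_top ?_
    (ENNReal.mul_ne_top hC (ENNReal.pow_ne_top (radialMass_one_ne_top h0 h1)))
  rcases le_or_gt r 0 with hr | hr
  · simp [Set.Ioo_eq_empty_of_le hr]
  · have hi : IntegrableOn (fun ρ : ℝ => ρ ^ (2 * α - 1)) (Set.Ioo 0 r) :=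
      (intervalIntegrable_iff_integrableOn_Ioo_of_le hr.le).1
        (intervalIntegral.intervalIntegrable_rpow' (by linarith))
    exact hi.lintegral_lt_top.ne

/-- The Biot-Savart kernel, without the factor `(2π)⁻¹`. -/
noncomputable def biotSavartKernel (z : ℂ) : ℂ := Complex.I * z / (((‖z‖ : ℝ) : ℂ) ^ 2)

lemma measurable_biotSavartKernel : Measurable biotSavartKernel := by
  unfold biotSavartKernel
  fun_prop

lemma biotSavartKernel_eq (z : ℂ) : biotSavartKernel z = Complex.I * (starRingEnd ℂ z)⁻¹ := by
  rcases eq_or_ne z 0 with rfl | hz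
  · simp [biotSavartKernel]
  · have hz' : starRingEnd ℂ z ≠ 0 := by simpa using hz
    rw [biotSavartKernel, ← Complex.mul_conj']
    field_simp

lemma enorm_biotSavartKernel_sq_le (z : ℂ) : ‖biotSavartKernel z‖ₑ ^ 2 ≤ (‖z‖ₑ ^ 2)⁻¹ := by
  rcases eq_or_ne z 0 with rfl | hz
  · simp [biotSavartKernel]
  · rw [biotSavartKernel_eq, enorm_mul, enorm_inv (by simpa using hz), ENNReal.inv_pow]
    simp [← ofReal_norm]

lemma norm_biotSavartKernel_sub_le {x y : ℂ} {d : ℝ} (hd : 0 < d) (hx : d ≤ ‖x‖) (hy : d ≤ ‖y‖) :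
    ‖biotSavartKernel x - biotSavartKernel y‖ ≤ ‖x - y‖ / d ^ 2 := by
  have hx0 : x ≠ 0 := norm_pos_iff.1 (hd.trans_le hx)
  have hy0 : y ≠ 0 := norm_pos_iff.1 (hd.trans_le hy)
  rw [biotSavartKernel_eq, biotSavartKernel_eq, ← mul_sub, inv_sub_inv (by simpa using hx0)
    (by simpa using hy0), ← map_sub, ← map_mul]
  simp only [norm_mul, Complex.norm_I, norm_div, one_mul, Complex.norm_conj, norm_sub_rev y x]
  rw [sq]
  gcongr

lemma norm_kadenCurve (μ t s : ℝ) : ‖kadenCurve μ t s‖ = |s| := by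
  rw [kadenCurve, mul_comm Complex.I, norm_mul, Complex.norm_exp_ofReal_mul_I, mul_one,
    Complex.norm_real, norm_eq_abs]

lemma measurable_kadenCurve (μ t : ℝ) : Measurable (kadenCurve μ t) := by
  unfold kadenCurve
  fun_prop

lemma kadenCurve_zero (μ s : ℝ) : kadenCurve μ 0 s = s := by
  simp [kadenCurve]

lemma kadenMeasure_eq_map (μ t : ℝ) :
    kadenMeasure μ t = Measure.map (kadenCurve μ t) (powerMeasure (2 - 1 / μ)) := by
  rw [kadenMeasure, powerMeasure, show (2 : ℝ) - 1 / μ - 1 = 1 - 1 / μ by ring]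

lemma biotSavart_kadenMeasure (μ t : ℝ) (z : ℂ) :
    biotSavart (kadenMeasure μ t) z =
      (2 * π)⁻¹ • ∫ s, biotSavartKernel (z - kadenCurve μ t s) ∂powerMeasure (2 - 1 / μ) := by
  have hK : biotSavart (kadenMeasure μ t) z =
      (2 * π)⁻¹ • ∫ u, biotSavartKernel (z - u) ∂kadenMeasure μ t := rfl
  rw [hK, kadenMeasure_eq_map, integral_map (measurable_kadenCurve μ t).aemeasurable
    (by have := measurable_biotSavartKernel; exact Measurable.aestronglyMeasurable (by fun_prop))]

lemma measurable_biotSavartKernel_kaden (μ t : ℝ) :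
    Measurable fun q : ℝ × ℂ => biotSavartKernel (q.2 - kadenCurve μ t q.1) :=
  measurable_biotSavartKernel.comp
    (measurable_snd.sub ((measurable_kadenCurve μ t).comp measurable_fst))

lemma stronglyMeasurable_biotSavart_kadenMeasure (μ t : ℝ) :
    StronglyMeasurable (biotSavart (kadenMeasure μ t)) := by
  simp only [funext (biotSavart_kadenMeasure μ t)]
  exact (measurable_biotSavartKernel_kaden μ t).stronglyMeasurable.integral_prod_left'
    (μ := powerMeasure (2 - 1 / μ)) |>.const_smul (2 * π)⁻¹

lemma lintegral_circle_kernel_kaden_le (μ t : ℝ) {ρ s : ℝ} (hρ : 0 < ρ) (hs : 0 < s) (hne : s ≠ ρ) :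
    ∫⁻ θ in Set.Ioo (-π) π, ‖biotSavartKernel (circleMap 0 ρ θ - kadenCurve μ t s)‖ₑ ^ 2 ≤
      ENNReal.ofReal (2 * π) * radialWeight ρ s ^ 2 := by
  have hn : ‖kadenCurve μ t s‖ = s := by rw [norm_kadenCurve, abs_of_pos hs]
  refine (lintegral_mono fun θ => enorm_biotSavartKernel_sq_le _).trans
    ((lintegral_circle_inv_sq_le hρ (hn.trans_ne hne)).trans (le_of_eq ?_))
  rw [radialWeight_sq, ← ENNReal.ofReal_mul (by positivity), hn, div_eq_mul_inv]

lemma angularDensity_le {α C : ℝ} {f : ℝ → ℂ → ℝ≥0∞} {p : ℝ × ℝ}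
    (h : ∫⁻ θ in Set.Ioo (-π) π, f p.2 (circleMap 0 p.1 θ) ^ 2 ≤
      ENNReal.ofReal C * radialWeight p.1 p.2 ^ 2) :
    angularDensity α f p ≤
      ENNReal.ofReal p.1 * radialMass α p.1 * (ENNReal.ofReal C * radialWeight p.1 p.2) := by
  unfold angularDensity
  exact mul_le_mul_right ((mul_le_mul_right h _).trans (inv_radialWeight_mul_sq_le _ _ _)) _

lemma ae_radialProd (α r : ℝ) : ∀ᵐ p ∂radialProd α r, 0 < p.1 ∧ 0 < p.2 ∧ p.2 ≠ p.1 := by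
  refine Measure.ae_prod_iff_ae_ae ?_ |>.2 ?_
  · exact (measurableSet_lt measurable_const measurable_fst).inter
      ((measurableSet_lt measurable_const measurable_snd).inter
        (measurableSet_eq_fun measurable_snd measurable_fst).compl)
  · filter_upwards [ae_restrict_mem measurableSet_Ioo] with ρ hρ
    filter_upwards [ae_powerMeasure_pos_ne α ρ] with s hs
    exact ⟨hρ.1, hs⟩

section Kaden

variable {μ : ℝ}

lemma alpha_mem (hμ : μ ∈ Set.Ioo (1 / 2 : ℝ) 1) : 0 < 2 - 1 / μ ∧ 2 - 1 / μ < 1 := by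
  have h0 : 0 < μ := by linarith [hμ.1]
  have h1 : 1 / μ < 2 := by rw [div_lt_iff₀ h0]; linarith [hμ.1]
  have h2 : 1 < 1 / μ := by rw [lt_div_iff₀ h0]; linarith [hμ.2]
  constructor <;> linarith

lemma lintegral_ball_kernel_sq_lt_top (hμ : μ ∈ Set.Ioo (1 / 2 : ℝ) 1) (r t : ℝ) :
    ∫⁻ z in ball (0 : ℂ) r,
      (∫⁻ s, ‖biotSavartKernel (z - kadenCurve μ t s)‖ₑ ∂powerMeasure (2 - 1 / μ)) ^ 2 < ∞ := by
  refine (lintegral_ball_sq_le _ r (f := fun s z => ‖biotSavartKernel (z - kadenCurve μ t s)‖ₑ)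
    (measurable_biotSavartKernel_kaden μ t).enorm).trans_lt (lt_of_le_of_lt (lintegral_mono_ae ?_)
      (lintegral_dominating_ne_top (alpha_mem hμ).1 (alpha_mem hμ).2 r
        (ENNReal.ofReal_ne_top (r := 2 * π))).lt_top)
  filter_upwards [ae_radialProd (2 - 1 / μ) r] with p hp
  exact angularDensity_le (lintegral_circle_kernel_kaden_le μ t hp.1 hp.2.1 hp.2.2)

lemma ae_integrable_kernel_kaden (hμ : μ ∈ Set.Ioo (1 / 2 : ℝ) 1) (r t : ℝ) :
    ∀ᵐ z ∂(volume : Measure ℂ).restrict (ball 0 r),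
      Integrable (fun s => biotSavartKernel (z - kadenCurve μ t s)) (powerMeasure (2 - 1 / μ)) := by
  have hK := measurable_biotSavartKernel_kaden μ t
  filter_upwards [ae_lt_top (hK.enorm.lintegral_prod_left'.pow_const 2)
    (lintegral_ball_kernel_sq_lt_top hμ r t).ne] with z hz
  refine ⟨(hK.comp measurable_prodMk_right).aestronglyMeasurable, ?_⟩
  by_contra h
  rw [HasFiniteIntegral, not_lt, top_le_iff] at h
  simp only [h] at hz
  exact absurd hz (by simp)

lemma enorm_two_pi_inv_smul_le (v : ℂ) : ‖(2 * π)⁻¹ • v‖ₑ ≤ ‖v‖ₑ := by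
  rw [← ofReal_norm, ← ofReal_norm, norm_smul]
  refine ENNReal.ofReal_le_ofReal (mul_le_of_le_one_left (norm_nonneg _) ?_)
  rw [Real.norm_of_nonneg (by positivity)]
  exact inv_le_one_of_one_le₀ (by linarith [Real.pi_gt_three])

lemma memLp_biotSavart_kadenMeasure (hμ : μ ∈ Set.Ioo (1 / 2 : ℝ) 1) (r t : ℝ) :
    MemLp (biotSavart (kadenMeasure μ t)) 2 ((volume : Measure ℂ).restrict (ball 0 r)) := by
  refine ⟨(stronglyMeasurable_biotSavart_kadenMeasure μ t).aestronglyMeasurable, ?_⟩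
  rw [eLpNorm_lt_top_iff_lintegral_rpow_enorm_lt_top two_ne_zero ENNReal.ofNat_ne_top]
  refine lt_of_le_of_lt (lintegral_mono fun z => ?_) (lintegral_ball_kernel_sq_lt_top hμ r t)
  simp only [ENNReal.toReal_ofNat, ENNReal.rpow_ofNat]
  rw [biotSavart_kadenMeasure]
  gcongr
  exact (enorm_two_pi_inv_smul_le _).trans (enorm_integral_le_lintegral_enorm _)

/-- Distance between the kernels of the spiral at time `t` and of the half-line. -/
noncomputable def kernelDiff (μ t s : ℝ) (z : ℂ) : ℝ≥0∞ :=
  ‖biotSavartKernel (z - kadenCurve μ t s) - biotSavartKernel (z - kadenCurve μ 0 s)‖ₑ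

lemma measurable_kernelDiff (μ t : ℝ) : Measurable (Function.uncurry (kernelDiff μ t)) :=
  ((measurable_biotSavartKernel_kaden μ t).sub (measurable_biotSavartKernel_kaden μ 0)).enorm

lemma lintegral_circle_kernelDiff_le (μ t : ℝ) {ρ s : ℝ} (hρ : 0 < ρ) (hs : 0 < s) (hne : s ≠ ρ) :
    ∫⁻ θ in Set.Ioo (-π) π, kernelDiff μ t s (circleMap 0 ρ θ) ^ 2 ≤
      ENNReal.ofReal (8 * π) * radialWeight ρ s ^ 2 := by
  have hmeas : ∀ t, Measurable fun θ =>
      ‖biotSavartKernel (circleMap 0 ρ θ - kadenCurve μ t s)‖ₑ ^ 2 := fun t =>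
    (((measurable_biotSavartKernel_kaden μ t).comp
      (measurable_const.prodMk (continuous_circleMap 0 ρ).measurable)).enorm).pow_const 2
  have hsq : ∀ a b : ℝ≥0∞, (a + b) ^ 2 ≤ 2 * (a ^ 2 + b ^ 2) := fun a b => by
    have := ENNReal.rpow_add_le_mul_rpow_add_rpow a b (one_le_two (α := ℝ))
    norm_num at this
    exact this
  calc ∫⁻ θ in Set.Ioo (-π) π, kernelDiff μ t s (circleMap 0 ρ θ) ^ 2
      ≤ ∫⁻ θ in Set.Ioo (-π) π, 2 * (‖biotSavartKernel (circleMap 0 ρ θ - kadenCurve μ t s)‖ₑ ^ 2 +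
          ‖biotSavartKernel (circleMap 0 ρ θ - kadenCurve μ 0 s)‖ₑ ^ 2) :=
        lintegral_mono fun θ => (pow_le_pow_left' enorm_sub_le 2).trans (hsq _ _)
    _ ≤ 2 * (ENNReal.ofReal (2 * π) * radialWeight ρ s ^ 2 +
          ENNReal.ofReal (2 * π) * radialWeight ρ s ^ 2) := by
        rw [lintegral_const_mul' _ _ ENNReal.ofNat_ne_top, lintegral_add_left (hmeas t)]
        gcongr <;> exact lintegral_circle_kernel_kaden_le μ _ hρ hs hne
    _ = _ := by
        rw [show 8 * π = 4 * (2 * π) by ring, ENNReal.ofReal_mul (p := 4) (by norm_num),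
          ENNReal.ofReal_ofNat]
        ring

lemma tendsto_lintegral_circle_kernelDiff (μ : ℝ) {ρ s : ℝ} (hρ : 0 < ρ) (hs : 0 < s)
    (hne : s ≠ ρ) :
    Tendsto (fun t => ∫⁻ θ in Set.Ioo (-π) π, kernelDiff μ t s (circleMap 0 ρ θ) ^ 2)
      (𝓝 0) (𝓝 0) := by
  have hd : 0 < |ρ - s| := abs_pos.2 (sub_ne_zero.2 hne.symm)
  have hdist : ∀ t θ, |ρ - s| ≤ ‖circleMap 0 ρ θ - kadenCurve μ t s‖ := fun t θ => by
    have := abs_norm_sub_norm_le (circleMap 0 ρ θ) (kadenCurve μ t s)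
    rwa [norm_circleMap_zero, norm_kadenCurve, abs_of_pos hρ, abs_of_pos hs] at this
  have hle : ∀ t, ∫⁻ θ in Set.Ioo (-π) π, kernelDiff μ t s (circleMap 0 ρ θ) ^ 2 ≤
      ENNReal.ofReal (‖kadenCurve μ t s - kadenCurve μ 0 s‖ / |ρ - s| ^ 2) ^ 2 *
        ENNReal.ofReal (2 * π) := fun t => by
    calc _ ≤ ∫⁻ θ in Set.Ioo (-π) π,
          ENNReal.ofReal (‖kadenCurve μ t s - kadenCurve μ 0 s‖ / |ρ - s| ^ 2) ^ 2 := by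
          refine lintegral_mono fun θ => pow_le_pow_left' ?_ 2
          rw [kernelDiff, ← ofReal_norm]
          refine ENNReal.ofReal_le_ofReal
            ((norm_biotSavartKernel_sub_le hd (hdist t θ) (hdist 0 θ)).trans (le_of_eq ?_))
          rw [sub_sub_sub_cancel_left, norm_sub_rev]
      _ = _ := by
          rw [lintegral_const, Measure.restrict_apply_univ, Real.volume_Ioo]
          ring_nf
  refine tendsto_of_tendsto_of_tendsto_of_le_of_le tendsto_const_nhds ?_ (fun t => zero_le) hle
  have hcont : Continuous fun t =>
      ENNReal.ofReal (‖kadenCurve μ t s - kadenCurve μ 0 s‖ / |ρ - s| ^ 2) ^ 2 *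
        ENNReal.ofReal (2 * π) := by
    refine ENNReal.continuous_mul_const ENNReal.ofReal_ne_top |>.comp
      ((ENNReal.continuous_pow 2).comp (ENNReal.continuous_ofReal.comp ?_))
    unfold kadenCurve
    fun_prop
  simpa using hcont.tendsto 0

lemma tendsto_lintegral_angularDensity_kernelDiff (hμ : μ ∈ Set.Ioo (1 / 2 : ℝ) 1) (r : ℝ) :
    Tendsto (fun t => ∫⁻ p, angularDensity (2 - 1 / μ) (kernelDiff μ t) p
      ∂radialProd (2 - 1 / μ) r) (𝓝 0) (𝓝 0) := by
  obtain ⟨hα0, hα1⟩ := alpha_mem hμ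
  rw [← lintegral_zero (μ := radialProd (2 - 1 / μ) r)]
  refine tendsto_lintegral_filter_of_dominated_convergence _
    (.of_forall fun t => measurable_angularDensity _ (measurable_kernelDiff μ t))
    (.of_forall fun t => ?_)
    (lintegral_dominating_ne_top hα0 hα1 r (ENNReal.ofReal_ne_top (r := 8 * π))) ?_
  · filter_upwards [ae_radialProd (2 - 1 / μ) r] with p hp
    exact angularDensity_le (lintegral_circle_kernelDiff_le μ t hp.1 hp.2.1 hp.2.2)
  · filter_upwards [ae_radialProd (2 - 1 / μ) r] with p hp
    have hm : radialMass (2 - 1 / μ) p.1 ≠ ∞ := by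
      rw [radialMass_eq hα0 hp.1]
      exact ENNReal.mul_ne_top ENNReal.ofReal_ne_top (radialMass_one_ne_top hα0 hα1)
    have hw := ENNReal.inv_ne_top.2 (radialWeight_ne_zero hp.1 hp.2.1 hp.2.2)
    have h1 := ENNReal.Tendsto.const_mul
      (tendsto_lintegral_circle_kernelDiff μ hp.1 hp.2.1 hp.2.2) (Or.inr hw)
    have h2 := ENNReal.Tendsto.const_mul h1
      (Or.inr (ENNReal.mul_ne_top (ENNReal.ofReal_ne_top (r := p.1)) hm))
    simpa [angularDensity] using h2

lemma tendsto_lintegral_biotSavart_sub (hμ : μ ∈ Set.Ioo (1 / 2 : ℝ) 1) (r : ℝ) :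
    Tendsto (fun t => ∫⁻ z in ball (0 : ℂ) r,
      ‖biotSavart (kadenMeasure μ t) z - biotSavart (kadenMeasure μ 0) z‖ₑ ^ 2) (𝓝 0) (𝓝 0) := by
  refine tendsto_of_tendsto_of_tendsto_of_le_of_le tendsto_const_nhds
    (tendsto_lintegral_angularDensity_kernelDiff hμ r) (fun t => zero_le) fun t => ?_
  refine (lintegral_mono_ae ?_).trans (lintegral_ball_sq_le _ r (measurable_kernelDiff μ t))
  filter_upwards [ae_integrable_kernel_kaden hμ r t, ae_integrable_kernel_kaden hμ r 0] with z h h'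
  rw [biotSavart_kadenMeasure, biotSavart_kadenMeasure, ← smul_sub, ← integral_sub h h']
  gcongr
  exact (enorm_two_pi_inv_smul_le _).trans (enorm_integral_le_lintegral_enorm _)

end Kaden

lemma eLpNorm_two_sq {X : Type*} [MeasurableSpace X] {ν : Measure X} (f : X → ℂ) :
    eLpNorm f 2 ν ^ 2 = ∫⁻ x, ‖f x‖ₑ ^ 2 ∂ν := by
  rw [eLpNorm_eq_lintegral_rpow_enorm_toReal two_ne_zero ENNReal.ofNat_ne_top,
    ← ENNReal.rpow_natCast, ← ENNReal.rpow_mul]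
  norm_num

/-- Proposition 4.5: as `t → 0⁺`, the Kaden velocity converges in `L²(B(0,r))` to the
velocity of the half-line vortex sheet `ω₀`; in particular the energies converge. -/
theorem stmt18 (μ : ℝ) (hμ : μ ∈ Set.Ioo (1 / 2 : ℝ) 1) (α : ℝ) (hα : α = 2 - 1 / μ)
    (r : ℝ) (hr : 0 < r) (ω0 : Measure ℂ)
    (h0 : ω0 = Measure.map (fun x : ℝ => (x : ℂ))
      (((volume : Measure ℝ).restrict (Set.Ioi 0)).withDensity
        (fun x => ENNReal.ofReal (α * x ^ (α - 1))))) :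
    Tendsto (fun t : ℝ => ∫⁻ x in ball (0 : ℂ) r,
        (‖biotSavart (kadenMeasure μ t) x - biotSavart ω0 x‖₊ : ℝ≥0∞) ^ 2)
      (nhdsWithin 0 (Set.Ioi 0)) (nhds 0) ∧
    Tendsto (fun t : ℝ => localEnergy (kadenMeasure μ t) r)
      (nhdsWithin 0 (Set.Ioi 0)) (nhds (localEnergy ω0 r)) := by
  have hω : ω0 = kadenMeasure μ 0 := by
    rw [h0, kadenMeasure_eq_map, funext (kadenCurve_zero μ), hα, powerMeasure]
  have hlim := (tendsto_lintegral_biotSavart_sub hμ r).mono_left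
    (nhdsWithin_le_nhds (s := Set.Ioi 0))
  rw [hω]
  refine ⟨hlim, ?_⟩
  have hmem := memLp_biotSavart_kadenMeasure hμ r
  have hsqrt : ∀ a : ℝ≥0∞, (a ^ 2) ^ (1 / 2 : ℝ) = a := fun a => by
    rw [← ENNReal.rpow_natCast, ← ENNReal.rpow_mul]; norm_num
  have hLp : Tendsto (fun t => (hmem t).toLp) (𝓝[>] 0) (𝓝 (hmem 0).toLp) := by
    rw [Lp.tendsto_Lp_iff_tendsto_eLpNorm'']
    have h := (ENNReal.continuous_rpow_const (y := 1 / 2)).tendsto 0 |>.comp hlim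
    rw [ENNReal.zero_rpow_of_pos (by norm_num)] at h
    refine h.congr fun t => ?_
    exact (congrArg (· ^ (1 / 2 : ℝ)) (eLpNorm_two_sq _).symm).trans (hsqrt _)
  have henergy : ∀ t, localEnergy (kadenMeasure μ t) r = ‖(hmem t).toLp‖ₑ ^ 2 := fun t => by
    rw [Lp.enorm_toLp, eLpNorm_two_sq]; rfl
  simp_rw [henergy]
  exact ((ENNReal.continuous_pow 2).comp continuous_enorm).tendsto _ |>.comp hLp
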